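/- arXiv:2402.14620 — 2 statements merged into one kernel-verified Lean document; each statement's English description precedes it below -/
import Mathlib

section
/- Let G ~ G(n,m) for some m ∈ {1, …, C(n,2)} and let r ≥ 2 and d ≥ 0 be integers. With probability at least 1 − e^{−n}, each part of every r-cut of G with deficit at most d has at most n/r + 4·max{√(d/m), (n/m)^{1/4}}·n vertices. -/
open scoped Classical

noncomputable section

/-- The possible edges of a graph on vertex set `Fin n`. -/
abbrev EdgeType (n : ℕ) := {e : Sym2 (Fin n) // ¬ e.IsDiag}

/-- A graph on vertex set `Fin n`, identified with its edge set. -/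
abbrev EdgeGraph (n : ℕ) := Finset (EdgeType n)

/-- The size of the `r`-cut given by `φ` in `G`. -/
def cutSize {n r : ℕ} (φ : Fin n → Fin r) (G : EdgeGraph n) : ℕ :=
  (G.filter fun e => ¬ (Sym2.map φ (e : Sym2 (Fin n))).IsDiag).card

/-- The maximum size of an `r`-cut of `G`. -/
def maxCut (n r : ℕ) (G : EdgeGraph n) : ℕ :=
  Finset.univ.sup fun φ : Fin n → Fin r => cutSize φ G

/-- The deficit of the `r`-cut `φ` in `G`. -/
def deficit {n : ℕ} (r : ℕ) (φ : Fin n → Fin r) (G : EdgeGraph n) : ℕ :=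
  maxCut n r G - cutSize φ G

/-- Probability of the event `A` under the uniform random graph `G(n,m)`. -/
def prGnm (n m : ℕ) (A : EdgeGraph n → Prop) : ℝ :=
  ((Finset.univ.filter fun G : EdgeGraph n => G.card = m ∧ A G).card : ℝ) /
    ((Finset.univ.filter fun G : EdgeGraph n => G.card = m).card : ℝ)

lemma choose_sub_le (N m k : ℕ) (hkm : k ≤ m) (hmN : m ≤ N) :
    ((N - k).choose (m - k) : ℝ) ≤ N.choose m * ((m : ℝ) / N) ^ k := by
  induction k with
  | zero => simp
  | succ k ih =>
    have ih := ih (by omega)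
    obtain ⟨a, rfl⟩ : ∃ a, m = k + 1 + a := ⟨m - (k + 1), by omega⟩
    obtain ⟨b, rfl⟩ : ∃ b, N = k + 1 + b := ⟨N - (k + 1), by omega⟩
    have e1 : k + 1 + b - k = b + 1 := by omega
    have e2 : k + 1 + a - k = a + 1 := by omega
    have e3 : k + 1 + b - (k + 1) = b := by omega
    have e4 : k + 1 + a - (k + 1) = a := by omega
    rw [e1, e2] at ih
    rw [e3, e4, pow_succ, ← mul_assoc]
    have hab : (a : ℝ) ≤ b := by exact_mod_cast (by omega : a ≤ b)
    have hs : ((b : ℝ) + 1) * b.choose a = (b + 1).choose (a + 1) * (a + 1) := by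
      exact_mod_cast Nat.add_one_mul_choose_eq b a
    have hs' : (b.choose a : ℝ) = (b + 1).choose (a + 1) * (((a : ℝ) + 1) / (b + 1)) := by
      field_simp
      linarith
    rw [hs']
    refine mul_le_mul ih ?_ (by positivity) (by positivity)
    push_cast
    rw [div_le_div_iff₀ (by positivity) (by positivity)]
    nlinarith [(Nat.cast_nonneg k : (0 : ℝ) ≤ k)]

section Hypergeometric

variable {α : Type*} [Fintype α] [DecidableEq α]

/-- Generating-function bound for the hypergeometric distribution. -/
lemma sum_powersetCard_pow_card_inter_le (m : ℕ) (hm : m ≤ Fintype.card α) (S : Finset α)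
    {x : ℝ} (hx : 0 ≤ x) :
    ∑ G ∈ Finset.powersetCard m (Finset.univ : Finset α), (1 + x) ^ (G ∩ S).card ≤
      (Fintype.card α).choose m * (1 + x * ((m : ℝ) / Fintype.card α)) ^ S.card := by
  have h1 : ∀ G : Finset α, (1 + x) ^ (G ∩ S).card =
      ∑ T ∈ S.powerset, if T ⊆ G then x ^ T.card else 0 := by
    intro G
    rw [← Finset.sum_filter]
    have : S.powerset.filter (· ⊆ G) = (G ∩ S).powerset := by
      ext T
      simp only [Finset.mem_filter, Finset.mem_powerset, Finset.subset_inter_iff]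
      tauto
    rw [this, ← Finset.prod_const, Finset.prod_one_add]
    simp
  simp_rw [h1]
  rw [Finset.sum_comm, ← Finset.prod_const, Finset.prod_one_add, Finset.mul_sum]
  refine Finset.sum_le_sum fun T _ => ?_
  rw [← Finset.sum_filter, Finset.sum_const, nsmul_eq_mul, Finset.prod_const, mul_pow]
  by_cases hT : T.card ≤ m
  · rw [Finset.card_filter_powersetCard_subset T _ m (Finset.subset_univ T) hT, Finset.card_univ]
    have := choose_sub_le (Fintype.card α) m T.card hT hm
    calc _ ≤ ((Fintype.card α).choose m * ((m : ℝ) / Fintype.card α) ^ T.card) * x ^ T.card := by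
          gcongr
      _ = _ := by ring
  · rw [Finset.filter_eq_empty_iff.mpr]
    · simp only [Finset.card_empty, Nat.cast_zero, zero_mul]
      positivity
    · intro G hG hTG
      exact hT ((Finset.card_le_card hTG).trans (Finset.mem_powersetCard.mp hG).2.le)

/-- Chernoff bound for the upper tail of the hypergeometric distribution. -/
lemma card_filter_hypergeometric_tail_le (m : ℕ) (hm : m ≤ Fintype.card α) (S : Finset α)
    {l t : ℝ} (hl : 0 ≤ l) (hl1 : l ≤ 1) :
    (((Finset.powersetCard m (Finset.univ : Finset α)).filter fun G =>
        (m : ℝ) * S.card / Fintype.card α + t < (G ∩ S).card).card : ℝ) ≤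
      (Fintype.card α).choose m * Real.exp (m * l ^ 2 - l * t) := by
  set μ : ℝ := (m : ℝ) * S.card / Fintype.card α with hμ
  have hx : 0 ≤ Real.exp l - 1 := by linarith [Real.add_one_le_exp l]
  have hμm : μ ≤ m := by
    rw [hμ]
    apply div_le_of_le_mul₀ (by positivity) (by positivity)
    gcongr
    exact Finset.card_le_univ S
  have hμ0 : 0 ≤ μ := by positivity
  have hexp : Real.exp l - 1 - l ≤ l ^ 2 :=
    (le_abs_self _).trans (Real.abs_exp_sub_one_sub_id_le (by rwa [abs_of_nonneg hl]))
  have hsum := sum_powersetCard_pow_card_inter_le m hm S hx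
  have hpow : (1 + (Real.exp l - 1) * ((m : ℝ) / Fintype.card α)) ^ S.card ≤
      Real.exp (μ * (Real.exp l - 1)) := by
    calc _ ≤ (Real.exp ((Real.exp l - 1) * ((m : ℝ) / Fintype.card α))) ^ S.card := by
          gcongr
          linarith [Real.add_one_le_exp ((Real.exp l - 1) * ((m : ℝ) / Fintype.card α))]
      _ = _ := by
          rw [← Real.exp_nat_mul]
          congr 1
          rw [hμ]
          ring
  have hlow : (((Finset.powersetCard m (Finset.univ : Finset α)).filter fun G =>
        μ + t < (G ∩ S).card).card : ℝ) * Real.exp (l * (μ + t)) ≤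
      ∑ G ∈ Finset.powersetCard m (Finset.univ : Finset α),
        (1 + (Real.exp l - 1)) ^ (G ∩ S).card := by
    rw [← nsmul_eq_mul, ← Finset.sum_const]
    refine (Finset.sum_le_sum fun G hG => ?_).trans
      (Finset.sum_le_sum_of_subset_of_nonneg (Finset.filter_subset _ _) fun G _ _ => by positivity)
    rw [add_sub_cancel, ← Real.exp_nat_mul]
    apply Real.exp_le_exp.mpr
    nlinarith [(Finset.mem_filter.mp hG).2]
  rw [← le_div_iff₀ (Real.exp_pos _)] at hlow
  refine hlow.trans ((div_le_div_of_nonneg_right (hsum.trans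
    (mul_le_mul_of_nonneg_left hpow (by positivity))) (Real.exp_pos _).le).trans ?_)
  rw [mul_div_assoc, ← Real.exp_sub]
  refine mul_le_mul_of_nonneg_left (Real.exp_le_exp.mpr ?_) (by positivity)
  nlinarith [mul_le_mul_of_nonneg_left hexp hμ0, mul_le_mul_of_nonneg_right hμm (sq_nonneg l)]

end Hypergeometric

section RandomColouring

variable {V C : Type*} [Fintype V] [DecidableEq V] [Fintype C]

lemma sum_prod_weight (w : V → C → ℝ) (hw : ∀ v, ∑ c, w v c = 1) :
    ∑ ψ : V → C, ∏ v, w v (ψ v) = 1 := by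
  rw [← Fintype.prod_sum]
  simp [hw]

/-- Two distinct vertices coloured independently agree with probability `∑ c, w u c * w v c`. -/
lemma sum_prod_weight_mul_eq [DecidableEq C] (w : V → C → ℝ) (hw : ∀ v, ∑ c, w v c = 1) {u v : V} (huv : u ≠ v) :
    ∑ ψ : V → C, (∏ x, w x (ψ x)) * (if ψ u = ψ v then 1 else 0) = ∑ c, w u c * w v c := by
  have h : ∀ ψ : V → C, (∏ x, w x (ψ x)) * (if ψ u = ψ v then (1 : ℝ) else 0) =
      ∑ c, ∏ x, w x (ψ x) * (if x = u ∨ x = v then (if ψ x = c then 1 else 0) else 1) := by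
    intro ψ
    have h2 : ∀ c, ∏ x, (if x = u ∨ x = v then (if ψ x = c then (1 : ℝ) else 0) else 1) =
        (if ψ u = c then 1 else 0) * (if ψ v = c then 1 else 0) := by
      intro c
      rw [← Finset.prod_filter]
      have : Finset.univ.filter (fun x => x = u ∨ x = v) = {u, v} := by ext; simp
      rw [this, Finset.prod_pair huv]
    simp_rw [Finset.prod_mul_distrib, h2, ← Finset.mul_sum]
    congr 1
    simp [eq_comm]
  simp_rw [h]
  rw [Finset.sum_comm]
  refine Finset.sum_congr rfl fun c _ => ?_
  rw [← Fintype.prod_sum (fun x y => w x y *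
    (if x = u ∨ x = v then (if y = c then (1 : ℝ) else 0) else 1))]
  have h3 : ∀ x, ∑ y, w x y * (if x = u ∨ x = v then (if y = c then (1 : ℝ) else 0) else 1) =
      if x = u ∨ x = v then w x c else 1 := by
    intro x
    split_ifs <;> simp [hw]
  simp_rw [h3]
  rw [← Finset.prod_filter]
  have : Finset.univ.filter (fun x => x = u ∨ x = v) = {u, v} := by ext; simp
  rw [this, Finset.prod_pair huv]

end RandomColouring

/-- The edges with both endpoints in `A`. -/
def edgesInside {n : ℕ} (A : Finset (Fin n)) : Finset (EdgeType n) :=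
  Finset.univ.filter fun e => ∀ v ∈ (e : Sym2 (Fin n)), v ∈ A

/-- The edges with exactly one endpoint in `A`. -/
def edgesAcross {n : ℕ} (A : Finset (Fin n)) : Finset (EdgeType n) :=
  Finset.univ.filter fun e => ∃ u ∈ A, ∃ v ∉ A, (e : Sym2 (Fin n)) = s(u, v)

lemma card_edgesInside {n : ℕ} (A : Finset (Fin n)) : (edgesInside A).card = A.card.choose 2 := by
  rw [← Sym2.card_image_offDiag, ← Finset.card_map (Function.Embedding.subtype _)]
  congr 1
  ext e
  induction e using Sym2.ind with
  | _ x y =>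
    simp only [edgesInside, Finset.mem_map, Finset.mem_filter, Finset.mem_univ, true_and,
      Function.Embedding.coe_subtype, Subtype.exists, Finset.mem_image, Finset.mem_offDiag,
      Prod.exists, Function.uncurry_apply_pair]
    constructor
    · rintro ⟨e, he, h, rfl⟩
      exact ⟨x, y, ⟨h x (by simp), h y (by simp), by simpa using he⟩, rfl⟩
    · rintro ⟨a, b, ⟨ha, hb, hab⟩, h⟩
      refine ⟨s(x, y), ?_, ?_, rfl⟩
      · rw [← h]
        simpa using hab
      · rw [← h]
        simp [ha, hb]

lemma card_edgesAcross_le {n : ℕ} (A : Finset (Fin n)) :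
    (edgesAcross A).card ≤ A.card * (n - A.card) := by
  have hc : (Aᶜ).card = n - A.card := by rw [Finset.card_compl, Fintype.card_fin]
  rw [← hc, ← Finset.card_product, ← Finset.card_map (Function.Embedding.subtype _)]
  refine (Finset.card_le_card (t := (A ×ˢ Aᶜ).image (Sym2.mk.uncurry)) ?_).trans
    Finset.card_image_le
  intro e he
  simp only [edgesAcross, Finset.mem_map, Finset.mem_filter, Finset.mem_univ, true_and] at he
  obtain ⟨e, ⟨u, hu, v, hv, h⟩, rfl⟩ := he
  exact Finset.mem_image.mpr ⟨(u, v), by simp [hu, hv], h.symm⟩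

lemma cutSize_eq_sum {n r : ℕ} (φ : Fin n → Fin r) (G : EdgeGraph n) :
    (cutSize φ G : ℝ) =
      ∑ e ∈ G, (1 - if (Sym2.map φ (e : Sym2 (Fin n))).IsDiag then (1 : ℝ) else 0) := by
  have hG : (do let a ← G; pure (a : Sym2 (Fin n))) = G.map (Function.Embedding.subtype _) := by
    ext e
    simp
  rw [cutSize, Finset.natCast_card_filter, hG, Finset.sum_map]
  refine Finset.sum_congr rfl fun e _ => ?_
  split_ifs <;> simp_all

/-- Colour distribution of a vertex of colour `j` when every vertex of colour `i` is, with
probability `q`, moved to a uniformly random other colour. -/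
def moveWeight {r : ℕ} (i : Fin r) (q : ℝ) (j c : Fin r) : ℝ :=
  if j = i then (if c = i then 1 - q else q / (r - 1)) else (if c = j then 1 else 0)

section MoveWeight

variable {r : ℕ} (i : Fin r) (q : ℝ)

lemma sum_ite_eq_const (a b : ℝ) :
    ∑ c : Fin r, (if c = i then a else b) = a + (r - 1) * b := by
  have : ∀ c : Fin r, (if c = i then a else b) = (if c = i then a - b else 0) + b := by
    intro c
    split_ifs <;> ring
  simp_rw [this, Finset.sum_add_distrib]
  simp
  ring

lemma sum_moveWeight (hr : 2 ≤ r) (j : Fin r) : ∑ c, moveWeight i q j c = 1 := by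
  have hr' : (2 : ℝ) ≤ r := by exact_mod_cast hr
  have : (r : ℝ) - 1 ≠ 0 := by linarith
  unfold moveWeight
  split_ifs
  · rw [sum_ite_eq_const i]
    field_simp
    ring
  · simp

lemma moveWeight_nonneg (hr : 2 ≤ r) (hq : 0 ≤ q) (hq1 : q ≤ 1) (j c : Fin r) :
    0 ≤ moveWeight i q j c := by
  have hr' : (2 : ℝ) ≤ r := by exact_mod_cast hr
  have : 0 ≤ q / ((r : ℝ) - 1) := div_nonneg hq (by linarith)
  unfold moveWeight
  split_ifs <;> linarith

lemma sum_moveWeight_mul (hr : 2 ≤ r) (j k : Fin r) :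
    ∑ c, moveWeight i q j c * moveWeight i q k c =
      (if j = k then 1 else 0)
        - (if j = i ∧ k = i then 2 * q - q ^ 2 * r / (r - 1) else 0)
        + (if (j = i ∧ k ≠ i) ∨ (k = i ∧ j ≠ i) then q / (r - 1) else 0) := by
  have hr' : (2 : ℝ) ≤ r := by exact_mod_cast hr
  have hne : (r : ℝ) - 1 ≠ 0 := by linarith
  by_cases hj : j = i <;> by_cases hk : k = i
  · have : ∀ c, moveWeight i q j c * moveWeight i q k c =
        if c = i then (1 - q) * (1 - q) else q / (r - 1) * (q / (r - 1)) := by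
      intro c
      simp only [moveWeight, hj, hk]
      split_ifs <;> simp_all
    simp_rw [this]
    rw [sum_ite_eq_const i]
    simp [hj, hk]
    field_simp
    ring
  · have hik : i ≠ k := fun h => hk h.symm
    simp [moveWeight, hj, hk, hik]
  · have hij : i ≠ j := fun h => hj h.symm
    simp only [moveWeight, hj, hk, if_false, if_true, ite_mul, one_mul, zero_mul,
      Finset.sum_ite_eq', Finset.mem_univ]
    simp [hj]
  · simp [moveWeight, hj, hk, eq_comm]

end MoveWeight

/-- Moving a random part of a colour class elsewhere bounds the maximum cut from below. -/
lemma cutSize_add_le_maxCut {n r : ℕ} (hr : 2 ≤ r) (φ : Fin n → Fin r) (i : Fin r)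
    (G : EdgeGraph n) {q : ℝ} (hq : 0 ≤ q) (hq1 : q ≤ 1) :
    (cutSize φ G : ℝ)
        + (2 * q - q ^ 2 * r / (r - 1)) * (G ∩ edgesInside (Finset.univ.filter (φ · = i))).card
        - q / (r - 1) * (G ∩ edgesAcross (Finset.univ.filter (φ · = i))).card ≤
      maxCut n r G := by
  set A := Finset.univ.filter (φ · = i) with hA
  set w : Fin n → Fin r → ℝ := fun v => moveWeight i q (φ v) with hw
  have hw1 : ∀ v, ∑ c, w v c = 1 := fun v => sum_moveWeight i q hr (φ v)
  have hedge : ∀ e : EdgeType n,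
      ∑ ψ : Fin n → Fin r, (∏ v, w v (ψ v)) *
        (1 - if (Sym2.map ψ (e : Sym2 (Fin n))).IsDiag then (1 : ℝ) else 0) =
      (1 - if (Sym2.map φ (e : Sym2 (Fin n))).IsDiag then (1 : ℝ) else 0)
        + (if e ∈ edgesInside A then 2 * q - q ^ 2 * r / (r - 1) else 0)
        - (if e ∈ edgesAcross A then q / (r - 1) else 0) := by
    rintro ⟨e, he⟩
    induction e using Sym2.ind with
    | _ x y =>
      have hxy : x ≠ y := by simpa using he
      have hin : (⟨s(x, y), he⟩ : EdgeType n) ∈ edgesInside A ↔ φ x = i ∧ φ y = i := by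
        simp [edgesInside, hA]
      have hac : (⟨s(x, y), he⟩ : EdgeType n) ∈ edgesAcross A ↔
          (φ x = i ∧ φ y ≠ i) ∨ (φ y = i ∧ φ x ≠ i) := by
        simp only [edgesAcross, hA, Finset.mem_filter, Finset.mem_univ, true_and, Sym2.eq_iff]
        constructor
        · rintro ⟨u, hu, v, hv, ⟨rfl, rfl⟩ | ⟨rfl, rfl⟩⟩
          · exact Or.inl ⟨hu, hv⟩
          · exact Or.inr ⟨hu, hv⟩
        · rintro (⟨h1, h2⟩ | ⟨h1, h2⟩)
          · exact ⟨x, h1, y, h2, Or.inl ⟨rfl, rfl⟩⟩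
          · exact ⟨y, h1, x, h2, Or.inr ⟨rfl, rfl⟩⟩
      simp only [hin, hac, Sym2.map_mk, Sym2.mk_isDiag_iff, mul_sub, mul_one,
        Finset.sum_sub_distrib]
      rw [sum_prod_weight w hw1, sum_prod_weight_mul_eq w hw1 hxy, hw, sum_moveWeight_mul i q hr]
      ring
  have hsum : ∑ ψ : Fin n → Fin r, (∏ v, w v (ψ v)) * (cutSize ψ G : ℝ) =
      (cutSize φ G : ℝ) + (2 * q - q ^ 2 * r / (r - 1)) * (G ∩ edgesInside A).card
        - q / (r - 1) * (G ∩ edgesAcross A).card := by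
    simp_rw [cutSize_eq_sum, Finset.mul_sum]
    rw [Finset.sum_comm, Finset.sum_congr rfl fun e _ => hedge e]
    rw [Finset.sum_sub_distrib, Finset.sum_add_distrib, Finset.sum_ite_mem, Finset.sum_ite_mem]
    simp only [Finset.sum_const, nsmul_eq_mul]
    ring
  rw [← hsum]
  calc _ ≤ ∑ ψ : Fin n → Fin r, (∏ v, w v (ψ v)) * (maxCut n r G : ℝ) := by
        refine Finset.sum_le_sum fun ψ _ => mul_le_mul_of_nonneg_left ?_
          (Finset.prod_nonneg fun v _ => moveWeight_nonneg i q hr hq hq1 _ _)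
        exact_mod_cast Finset.le_sup (f := fun ψ : Fin n → Fin r => cutSize ψ G)
          (Finset.mem_univ ψ)
    _ = _ := by rw [← Finset.sum_mul, sum_prod_weight w hw1, one_mul]

lemma card_edgeType (n : ℕ) : Fintype.card (EdgeType n) = n.choose 2 := by
  have := Sym2.card_subtype_not_diag (α := Fin n)
  rw [Fintype.card_fin] at this
  convert this

/-- `G` has at most `t` more edges in `S` than expected of a random graph with `m` edges. -/
def HasFewEdgesIn {n : ℕ} (m : ℕ) (t : ℝ) (S : Finset (EdgeType n)) (G : EdgeGraph n) : Prop :=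
  ((G ∩ S).card : ℝ) ≤ (m : ℝ) * S.card / n.choose 2 + t

/-- The graph obeys the edge-count bounds used for every vertex set simultaneously. -/
def IsTypical {n : ℕ} (m : ℕ) (t : ℝ) (G : EdgeGraph n) : Prop :=
  ∀ A : Finset (Fin n), HasFewEdgesIn m t (edgesInside A)ᶜ G ∧ HasFewEdgesIn m t (edgesAcross A) G

lemma card_filter_card_eq (n m : ℕ) :
    (Finset.univ.filter fun G : EdgeGraph n => G.card = m).card = (n.choose 2).choose m := by
  rw [Finset.univ_filter_card_eq, Finset.card_powersetCard, Finset.card_univ,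
    card_edgeType]

lemma card_not_isTypical_le {n m : ℕ} (hn : 1 ≤ n) (hm : m ≤ n.choose 2) {l t : ℝ} (hl : 0 ≤ l)
    (hl1 : l ≤ 1) (hlt : m * l ^ 2 - l * t ≤ -(4 * n)) :
    ((Finset.univ.filter fun G : EdgeGraph n => G.card = m ∧ ¬ IsTypical m t G).card : ℝ) ≤
      (n.choose 2).choose m * Real.exp (-n) := by
  set bad : Finset (EdgeType n) → Finset (EdgeGraph n) := fun S =>
    Finset.univ.filter fun G => G.card = m ∧ ¬ HasFewEdgesIn m t S G with hbad
  have hb : ∀ S, ((bad S).card : ℝ) ≤ (n.choose 2).choose m * Real.exp (-(4 * n)) := by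
    intro S
    have h := card_filter_hypergeometric_tail_le (α := EdgeType n) m
      (by rwa [card_edgeType]) S (t := t) hl hl1
    rw [card_edgeType] at h
    have heq : bad S = (Finset.powersetCard m Finset.univ).filter fun G : EdgeGraph n =>
        (m : ℝ) * S.card / n.choose 2 + t < (G ∩ S).card := by
      ext G
      simp [hbad, HasFewEdgesIn, Finset.mem_powersetCard]
    rw [heq]
    exact h.trans (mul_le_mul_of_nonneg_left (Real.exp_le_exp.mpr hlt) (by positivity))
  have hsub : (Finset.univ.filter fun G : EdgeGraph n => G.card = m ∧ ¬ IsTypical m t G) ⊆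
      Finset.univ.biUnion fun A : Finset (Fin n) => bad (edgesInside A)ᶜ ∪ bad (edgesAcross A) := by
    intro G hG
    simp only [Finset.mem_filter, Finset.mem_univ, true_and, IsTypical, not_forall,
      not_and_or] at hG
    obtain ⟨hGm, A, hA⟩ := hG
    simp only [Finset.mem_biUnion, Finset.mem_union, hbad, Finset.mem_filter, Finset.mem_univ,
      true_and]
    exact ⟨A, hA.imp (⟨hGm, ·⟩) (⟨hGm, ·⟩)⟩
  have hcard : ((Finset.univ.filter fun G : EdgeGraph n =>
        G.card = m ∧ ¬ IsTypical m t G).card : ℝ) ≤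
      ∑ A : Finset (Fin n), (((bad (edgesInside A)ᶜ).card : ℝ) + (bad (edgesAcross A)).card) := by
    exact_mod_cast (Finset.card_le_card hsub).trans (Finset.card_biUnion_le.trans
      (Finset.sum_le_sum fun A _ => Finset.card_union_le _ _))
  refine hcard.trans ((Finset.sum_le_sum fun A _ => add_le_add (hb _) (hb _)).trans ?_)
  rw [Finset.sum_const, Finset.card_univ, Fintype.card_finset, Fintype.card_fin, nsmul_eq_mul]
  have h2 : (2 : ℝ) ≤ Real.exp 1 := by linarith [Real.add_one_le_exp (1 : ℝ)]
  have h2n : (2 : ℝ) ^ n * 2 ≤ Real.exp (n + 1) := by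
    rw [Real.exp_add]
    refine mul_le_mul ?_ h2 (by norm_num) (Real.exp_pos _).le
    calc (2 : ℝ) ^ n ≤ Real.exp 1 ^ n := by gcongr
      _ = _ := by rw [← Real.exp_nat_mul, mul_one]
  have hn' : (1 : ℝ) ≤ n := by exact_mod_cast hn
  have hfin : (2 : ℝ) ^ n * 2 * Real.exp (-(4 * n)) ≤ Real.exp (-n) := by
    refine (mul_le_mul_of_nonneg_right h2n (Real.exp_pos _).le).trans ?_
    rw [← Real.exp_add]
    exact Real.exp_le_exp.mpr (by linarith)
  push_cast
  calc _ = ((n.choose 2).choose m : ℝ) * ((2 : ℝ) ^ n * 2 * Real.exp (-(4 * n))) := by ring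
    _ ≤ _ := mul_le_mul_of_nonneg_left hfin (by positivity)

lemma one_sub_le_prGnm {n m : ℕ} (hm : m ≤ n.choose 2) {A B : EdgeGraph n → Prop} {ε : ℝ}
    (hAB : ∀ G : EdgeGraph n, G.card = m → B G → A G)
    (hB : ((Finset.univ.filter fun G : EdgeGraph n => G.card = m ∧ ¬ B G).card : ℝ) ≤
      (n.choose 2).choose m * ε) :
    1 - ε ≤ prGnm n m A := by
  have hpos : (0 : ℝ) < (n.choose 2).choose m := by exact_mod_cast Nat.choose_pos hm
  rw [prGnm, card_filter_card_eq, le_div_iff₀ hpos]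
  have hsplit : (n.choose 2).choose m ≤
      (Finset.univ.filter fun G : EdgeGraph n => G.card = m ∧ A G).card +
        (Finset.univ.filter fun G : EdgeGraph n => G.card = m ∧ ¬ B G).card := by
    rw [← card_filter_card_eq]
    refine (Finset.card_le_card fun G hG => ?_).trans (Finset.card_union_le _ _)
    simp only [Finset.mem_union, Finset.mem_filter, Finset.mem_univ, true_and] at hG ⊢
    by_cases h : B G
    · exact Or.inl ⟨hG, hAB G hG h⟩
    · exact Or.inr ⟨hG, h⟩
  have : ((n.choose 2).choose m : ℝ) ≤
      (Finset.univ.filter fun G : EdgeGraph n => G.card = m ∧ A G).card +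
        (Finset.univ.filter fun G : EdgeGraph n => G.card = m ∧ ¬ B G).card := by
    exact_mod_cast hsplit
  linarith

lemma le_card_inter_edgesInside {n m : ℕ} {t : ℝ} {G : EdgeGraph n} (hn : 2 ≤ n)
    (hG : G.card = m) (h : IsTypical m t G) (A : Finset (Fin n)) :
    (m : ℝ) * (A.card * (A.card - 1)) / (n * (n - 1)) - t ≤ (G ∩ edgesInside A).card := by
  have h1 := (h A).1
  have hsplit : (G ∩ edgesInside A).card + (G ∩ (edgesInside A)ᶜ).card = G.card := by
    rw [← Finset.sdiff_eq_inter_compl, Finset.card_inter_add_card_sdiff]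
  have hS : ((edgesInside A)ᶜ.card : ℝ) = n.choose 2 - (A.card.choose 2 : ℕ) := by
    rw [← card_edgesInside A, ← card_edgeType n, eq_sub_iff_add_eq]
    exact_mod_cast Finset.card_compl_add_card (edgesInside A)
  have hn' : (2 : ℝ) ≤ n := by exact_mod_cast hn
  have hn1 : (n : ℝ) - 1 ≠ 0 := by linarith
  have hn0 : (n : ℝ) ≠ 0 := by linarith
  rw [HasFewEdgesIn, hS, Nat.cast_choose_two, Nat.cast_choose_two] at h1
  have hsplit' : ((G ∩ edgesInside A).card : ℝ) + (G ∩ (edgesInside A)ᶜ).card = m := by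
    exact_mod_cast hsplit.trans hG
  have : (m : ℝ) * (n * (n - 1) / 2 - A.card * (A.card - 1) / 2) / (n * (n - 1) / 2) =
      m - (m : ℝ) * (A.card * (A.card - 1)) / (n * (n - 1)) := by
    field_simp
  rw [this] at h1
  linarith

lemma card_inter_edgesAcross_le {n m : ℕ} {t : ℝ} {G : EdgeGraph n} (hn : 2 ≤ n)
    (h : IsTypical m t G) (A : Finset (Fin n)) :
    ((G ∩ edgesAcross A).card : ℝ) ≤ 2 * (m : ℝ) * (A.card * (n - A.card)) / (n * (n - 1)) + t := by
  have h1 := (h A).2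
  have hA : A.card ≤ n := by simpa using Finset.card_le_univ A
  have hS : ((edgesAcross A).card : ℝ) ≤ A.card * (n - A.card) := by
    rw [← Nat.cast_sub hA]
    exact_mod_cast card_edgesAcross_le A
  have hn' : (2 : ℝ) ≤ n := by exact_mod_cast hn
  have hn1 : 0 < (n : ℝ) - 1 := by linarith
  rw [HasFewEdgesIn, Nat.cast_choose_two] at h1
  refine h1.trans (add_le_add_left ?_ t)
  rw [div_le_div_iff₀ (by positivity) (by positivity)]
  have : 0 ≤ (m : ℝ) * (n * (n - 1)) := by positivity
  nlinarith [mul_le_mul_of_nonneg_left hS this]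

lemma rebalancing_gain_ge_of_weights {n m M α β t x y c p : ℝ} (hm : 0 ≤ m) (hM0 : 0 ≤ M)
    (hMn : M ≤ n / 2) (hα0 : 0 ≤ α) (hα1 : α ≤ 1) (ht : 0 ≤ t) (hc0 : 0 ≤ c) (hp0 : 0 ≤ p)
    (hc1 : c + p ≤ 2) (hc2 : c + 2 * p ≤ 4)
    (hmain : β ^ 2 ≤ c * α ^ 2 - 2 * p * (α * (1 - α)))
    (hx : m * α ^ 2 - M * (α * (1 - α)) - t ≤ x)
    (hy : y ≤ 2 * m * (α * (1 - α)) + 2 * M * (α * (1 - α)) + t) :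
    β ^ 2 * m - 2 * t - n / 2 ≤ c * x - p * y := by
  have hx' := mul_le_mul_of_nonneg_left hx hc0
  have hy' := mul_le_mul_of_nonneg_left hy hp0
  have hmain' := mul_le_mul_of_nonneg_left hmain hm
  have hαα : α * (1 - α) ≤ 1 / 4 := by linarith [sq_nonneg (α - 1 / 2)]
  have hαα0 : 0 ≤ α * (1 - α) := mul_nonneg hα0 (by linarith)
  have hMα : M * (α * (1 - α)) ≤ n / 2 * (1 / 4) := mul_le_mul hMn hαα hαα0 (by linarith)
  have herr := mul_le_mul_of_nonneg_right hc2 (mul_nonneg hM0 hαα0)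
  have hterr := mul_le_mul_of_nonneg_right hc1 ht
  linarith

/-- The expected gain from rebalancing an oversized part of relative size `1 / r + β`. -/
lemma rebalancing_gain_ge {n m r a β t x y q : ℝ} (hn : 2 ≤ n) (hm : 0 ≤ m)
    (hmn : m ≤ n * (n - 1) / 2) (hr : 2 ≤ r) (hβ : 0 ≤ β) (ha : a = (1 / r + β) * n) (han : a ≤ n)
    (ht : 0 ≤ t) (hq : q = β / (1 / r + β))
    (hx : m * (a * (a - 1)) / (n * (n - 1)) - t ≤ x)
    (hy : y ≤ 2 * m * (a * (n - a)) / (n * (n - 1)) + t) :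
    β ^ 2 * m - 2 * t - n / 2 ≤ (2 * q - q ^ 2 * r / (r - 1)) * x - q / (r - 1) * y := by
  have hr0 : 0 < r := by linarith
  have hr1 : 0 < r - 1 := by linarith
  have hinv : 0 < 1 / r := by positivity
  obtain ⟨α, hα⟩ : ∃ α, α = 1 / r + β := ⟨_, rfl⟩
  rw [← hα] at ha hq
  have hα0 : 0 < α := by linarith
  have hα1 : α ≤ 1 := by
    rw [ha] at han
    exact le_of_mul_le_mul_right (by linarith) (by linarith : 0 < n)
  have hq0 : 0 ≤ q := by rw [hq]; positivity
  have hq1 : q ≤ 1 := by rw [hq]; exact (div_le_one hα0).mpr (by linarith)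
  have hp0 : 0 ≤ q / (r - 1) := by positivity
  have hpq : q / (r - 1) ≤ q := div_le_self hq0 (by linarith)
  have hcp : 2 * q - q ^ 2 * r / (r - 1) = 2 * q - q * (q + q / (r - 1)) := by
    field_simp
    ring
  have hn1 : 0 < n - 1 := by linarith
  have hn0 : n ≠ 0 := by linarith
  have e1 : m * (a * (a - 1)) / (n * (n - 1)) = m * α ^ 2 - m / (n - 1) * (α * (1 - α)) := by
    rw [ha]
    field_simp
    ring
  have e2 : 2 * m * (a * (n - a)) / (n * (n - 1)) =
      2 * m * (α * (1 - α)) + 2 * (m / (n - 1)) * (α * (1 - α)) := by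
    rw [ha]
    field_simp
    ring
  rw [e1] at hx
  rw [e2] at hy
  have hq_mul : 0 ≤ q * (1 - q) := mul_nonneg hq0 (by linarith)
  have hq_sub : 0 ≤ q * (q - q / (r - 1)) := mul_nonneg hq0 (by linarith)
  have hp_mul : 0 ≤ q / (r - 1) * q := mul_nonneg hp0 hq0
  refine rebalancing_gain_ge_of_weights hm (by positivity) ?_ hα0.le hα1 ht ?_ hp0 ?_ ?_ ?_ hx hy
  · rw [div_le_iff₀ hn1]
    linarith
  · rw [hcp]
    linarith
  · rw [hcp]
    linarith [sq_nonneg (q - 1)]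
  · rw [hcp]
    linarith [sq_nonneg (q - 1)]
  · have hmain : (2 * q - q ^ 2 * r / (r - 1)) * α ^ 2 - 2 * (q / (r - 1)) * (α * (1 - α)) =
        r / (r - 1) * β ^ 2 := by
      have hβr : β = α - 1 / r := by rw [hα]; ring
      rw [hq, hβr]
      field_simp
      ring
    rw [hmain]
    exact le_mul_of_one_le_left (sq_nonneg β) ((one_le_div hr1).mpr (by linarith))

/-- In a typical graph, an `r`-cut with a part of relative size `1 / r + β` has large deficit. -/
lemma le_deficit_of_isTypical {n m r : ℕ} {t β : ℝ} {G : EdgeGraph n} (hn : 2 ≤ n) (hr : 2 ≤ r)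
    (hm : m ≤ n.choose 2) (hG : G.card = m) (h : IsTypical m t G) (ht : 0 ≤ t) (hβ : 0 ≤ β)
    (φ : Fin n → Fin r) (i : Fin r)
    (ha : ((Finset.univ.filter (φ · = i)).card : ℝ) = (1 / r + β) * n) :
    β ^ 2 * m - 2 * t - n / 2 ≤ deficit r φ G := by
  have hr' : (2 : ℝ) ≤ r := by exact_mod_cast hr
  have hinv : 0 < 1 / (r : ℝ) := by positivity
  have hq0 : 0 ≤ β / (1 / (r : ℝ) + β) := by positivity
  have hq1 : β / (1 / (r : ℝ) + β) ≤ 1 := (div_le_one (by positivity)).mpr (by linarith)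
  have hcut := cutSize_add_le_maxCut hr φ i G hq0 hq1
  have hmn : (m : ℝ) ≤ n * (n - 1) / 2 := by
    rw [← Nat.cast_choose_two]
    exact_mod_cast hm
  have han : (Finset.univ.filter (φ · = i)).card ≤ n := by
    simpa using Finset.card_le_univ (Finset.univ.filter (φ · = i))
  have hgain := rebalancing_gain_ge (by exact_mod_cast hn) (Nat.cast_nonneg m) hmn hr' hβ ha
    (by exact_mod_cast han) ht rfl (le_card_inter_edgesInside hn hG h _)
    (card_inter_edgesAcross_le hn h _)
  have hdef : (maxCut n r G : ℝ) ≤ deficit r φ G + cutSize φ G := by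
    exact_mod_cast (by unfold deficit; omega : maxCut n r G ≤ deficit r φ G + cutSize φ G)
  linarith

/-- For `G ~ G(n,m)`: with probability at least `1 - e^{-n}`, each part of every `r`-cut of
`G` with deficit at most `d` has at most `n/r + 4 max{√(d/m), (n/m)^{1/4}} n` vertices. -/
theorem whp_small_deficit_cuts_balanced
    (n m r d : ℕ) (hm1 : 1 ≤ m) (hm : m ≤ n.choose 2) (hr : 2 ≤ r) :
    1 - Real.exp (-(n : ℝ)) ≤
      prGnm n m (fun G => ∀ φ : Fin n → Fin r, deficit r φ G ≤ d →
        ∀ i : Fin r,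
          ((Finset.univ.filter fun v : Fin n => φ v = i).card : ℝ) ≤
            (n : ℝ) / r +
              4 * max (Real.sqrt ((d : ℝ) / m)) (((n : ℝ) / m) ^ ((1 : ℝ) / 4)) * n) := by
  have hn : 2 ≤ n := by
    by_contra! h
    have := Nat.choose_eq_zero_of_lt h
    omega
  have hn' : (2 : ℝ) ≤ n := by exact_mod_cast hn
  have hm' : (1 : ℝ) ≤ m := by exact_mod_cast hm1
  have hm0 : (0 : ℝ) < m := by linarith
  have hr' : (2 : ℝ) ≤ r := by exact_mod_cast hr
  have hρ0 : 0 ≤ (n : ℝ) / m := by positivity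
  obtain ⟨s, hs⟩ : ∃ s, s = Real.sqrt ((n : ℝ) / m) := ⟨_, rfl⟩
  have hs0 : 0 ≤ s := hs ▸ Real.sqrt_nonneg _
  have hs2 : s ^ 2 * m = n := by
    rw [hs, Real.sq_sqrt hρ0]
    field_simp
  obtain ⟨δ, hδ⟩ : ∃ δ, δ = max (Real.sqrt ((d : ℝ) / m)) (((n : ℝ) / m) ^ ((1 : ℝ) / 4)) :=
    ⟨_, rfl⟩
  rw [← hδ]
  have hδs : s ≤ δ ^ 2 := by
    have h : ((n : ℝ) / m) ^ ((1 : ℝ) / 4) ≤ δ := hδ ▸ le_max_right _ _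
    calc s = (((n : ℝ) / m) ^ ((1 : ℝ) / 4)) ^ 2 := by
          rw [hs, Real.sqrt_eq_rpow, ← Real.rpow_natCast, ← Real.rpow_mul hρ0]
          norm_num
      _ ≤ δ ^ 2 := by gcongr
  have hδ0 : 0 ≤ δ := hδ ▸ (Real.sqrt_nonneg _).trans (le_max_left _ _)
  have hδd : (d : ℝ) ≤ δ ^ 2 * m := by
    have h : Real.sqrt ((d : ℝ) / m) ≤ δ := hδ ▸ le_max_left _ _
    rw [← div_le_iff₀ hm0]
    exact (Real.sqrt_le_left hδ0).mp h
  have hA (φ : Fin n → Fin r) (i : Fin r) :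
      ((Finset.univ.filter fun v : Fin n => φ v = i).card : ℝ) ≤ n := by
    exact_mod_cast (Finset.card_le_univ _).trans_eq (Fintype.card_fin n)
  by_cases hδ1 : 1 / 4 ≤ δ
  · refine one_sub_le_prGnm hm (B := fun _ => True) (fun G _ _ φ _ i => ?_) ?_
    · have h1 : 0 ≤ (n : ℝ) / r := by positivity
      nlinarith [hA φ i]
    · simp only [not_true_eq_false, and_false, Finset.filter_false, Finset.card_empty,
        Nat.cast_zero]
      positivity
  push Not at hδ1
  have hs1 : s ≤ 1 / 16 := by nlinarith
  refine one_sub_le_prGnm hm (B := IsTypical m (4 * s * m)) (fun G hG hT φ hφ i => ?_)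
    (card_not_isTypical_le (l := 2 * s) (by omega) hm (by positivity) (by linarith) ?_)
  · by_contra! hbig
    obtain ⟨β, hβ⟩ : ∃ β, β = ((Finset.univ.filter fun v : Fin n => φ v = i).card : ℝ) / n - 1 / r :=
      ⟨_, rfl⟩
    have ha : ((Finset.univ.filter fun v : Fin n => φ v = i).card : ℝ) = (1 / r + β) * n := by
      rw [hβ]
      field_simp
      ring
    have hβδ : 4 * δ ≤ β := by
      rw [ha] at hbig
      have : (n : ℝ) / r = 1 / r * n := by ring
      rw [this] at hbig
      exact le_of_mul_le_mul_right (by linarith) (by linarith : (0 : ℝ) < n)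
    have hdef := le_deficit_of_isTypical hn hr hm hG hT (by positivity) (by linarith) φ i ha
    have hd : (deficit r φ G : ℝ) ≤ d := by exact_mod_cast hφ
    have hβ2 : 16 * δ ^ 2 * m ≤ β ^ 2 * m := by
      gcongr
      nlinarith
    have hsm : s * m ≤ δ ^ 2 * m := by gcongr
    have hns : (n : ℝ) ≤ s * m := by
      rw [← hs2]
      gcongr
      nlinarith
    linarith
  · linarith

end
end

section
/- Fix an integer r ≥ 2 and a function assigning to every graph G on [n] a maximum r-cut Π_G of G, and define eq_{−1}^r(G) := int(Π_G), the set of unordered pairs of vertices lying in the same part of Π_G. Let N = C(n,2), let G_1 ~ G(n,m) and G_2 ~ G(n,m+1) for some m ∈ {0, …, N−1}. Then for every integer d ≥ −1: E|eq_{d+1}^r(G_1) ∖ E(G_1)| ≥ ((N − m)/(m + 1)) · E|eq_d^r(G_2) ∩ E(G_2)|. -/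
open scoped Classical

noncomputable section

/-- The set of pairs of `(d,r)`-equivalent vertices of `G`. -/
def eqPairs {n : ℕ} (d r : ℕ) (G : EdgeGraph n) : Finset (EdgeType n) :=
  Finset.univ.filter fun e =>
    ∀ φ : Fin n → Fin r, deficit r φ G ≤ d → (Sym2.map φ (e : Sym2 (Fin n))).IsDiag

/-- `eq_d^r(G)` for `d ≥ -1`, where for `d = -1` it is the set `int(Π_G)` of pairs lying in
the same part of the selected maximum `r`-cut `Π_G` of `G`. -/
def eqPairsZ {n : ℕ} (r : ℕ) (Pi : EdgeGraph n → (Fin n → Fin r)) (d : ℤ) (G : EdgeGraph n) :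
    Finset (EdgeType n) :=
  if d < 0 then
    Finset.univ.filter fun e => (Sym2.map (Pi G) (e : Sym2 (Fin n))).IsDiag
  else eqPairs d.toNat r G

/-- Expectation of `f` under the uniform random graph `G(n,m)`. -/
def exGnm (n m : ℕ) (f : EdgeGraph n → ℝ) : ℝ :=
  (∑ G ∈ Finset.univ.filter fun G : EdgeGraph n => G.card = m, f G) /
    ((Finset.univ.filter fun G : EdgeGraph n => G.card = m).card : ℝ)

lemma cutSize_le_maxCut {n r : ℕ} (φ : Fin n → Fin r) (G : EdgeGraph n) :
    cutSize φ G ≤ maxCut n r G :=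
  Finset.le_sup (f := fun φ : Fin n → Fin r => cutSize φ G) (Finset.mem_univ φ)

lemma cutSize_eq_card_filter {n r : ℕ} (φ : Fin n → Fin r) (G : EdgeGraph n) :
    cutSize φ G =
      (G.filter fun e : EdgeType n => ¬ (Sym2.map φ (e : Sym2 (Fin n))).IsDiag).card := by
  unfold cutSize
  rw [← Finset.card_image_of_injective _ Subtype.val_injective]
  congr 1
  ext e
  simp only [Finset.mem_filter, Finset.mem_image, Finset.bind_def, Finset.pure_def,
    Finset.mem_sup, Finset.mem_singleton]
  aesop

lemma cutSize_erase_of_isDiag {n r : ℕ} {φ : Fin n → Fin r} {G : EdgeGraph n} {e : EdgeType n}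
    (h : (Sym2.map φ (e : Sym2 (Fin n))).IsDiag) : cutSize φ (G.erase e) = cutSize φ G := by
  rw [cutSize_eq_card_filter, cutSize_eq_card_filter, Finset.filter_erase, Finset.erase_eq_of_notMem]
  simp [h]

lemma cutSize_erase_add_one {n r : ℕ} {φ : Fin n → Fin r} {G : EdgeGraph n} {e : EdgeType n}
    (he : e ∈ G) (h : ¬ (Sym2.map φ (e : Sym2 (Fin n))).IsDiag) :
    cutSize φ (G.erase e) + 1 = cutSize φ G := by
  rw [cutSize_eq_card_filter, cutSize_eq_card_filter, Finset.filter_erase, Finset.card_erase_add_one]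
  simp [h, he]

/-- Deleting an edge between `d`-equivalent vertices makes them `(d+1)`-equivalent. -/
lemma mem_eqPairsZ_erase {n r : ℕ} {Pi : EdgeGraph n → (Fin n → Fin r)}
    (hPi : ∀ G : EdgeGraph n, cutSize (Pi G) G = maxCut n r G) {d : ℤ} (hd : -1 ≤ d)
    {G : EdgeGraph n} {e : EdgeType n} (he : e ∈ G) (h : e ∈ eqPairsZ r Pi d G) :
    e ∈ eqPairsZ r Pi (d + 1) (G.erase e) := by
  have hdiag : (Sym2.map (Pi G) (e : Sym2 (Fin n))).IsDiag := by
    unfold eqPairsZ at h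
    split_ifs at h with h0
    · simpa using h
    · exact (Finset.mem_filter.1 h).2 (Pi G) (by simp [deficit, hPi])
  have hmax : maxCut n r G ≤ maxCut n r (G.erase e) := by
    rw [← hPi G, ← cutSize_erase_of_isDiag hdiag]
    exact cutSize_le_maxCut _ _
  rw [eqPairsZ, if_neg (by lia)]
  refine Finset.mem_filter.2 ⟨Finset.mem_univ _, fun φ hφ => ?_⟩
  by_contra hcut
  have hsize := cutSize_erase_add_one he hcut
  have hle := cutSize_le_maxCut φ G
  unfold deficit at hφ
  by_cases h0 : d < 0
  · have : (d + 1).toNat = 0 := by lia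
    lia
  · rw [eqPairsZ, if_neg h0] at h
    refine hcut ((Finset.mem_filter.1 h).2 φ ?_)
    unfold deficit
    lia

lemma sum_card_eqPairsZ_inter_le {n r : ℕ} {Pi : EdgeGraph n → (Fin n → Fin r)}
    (hPi : ∀ G : EdgeGraph n, cutSize (Pi G) G = maxCut n r G) (m : ℕ) {d : ℤ} (hd : -1 ≤ d) :
    ∑ G ∈ Finset.univ.filter fun G : EdgeGraph n => G.card = m + 1,
        (eqPairsZ r Pi d G ∩ G).card ≤
      ∑ G ∈ Finset.univ.filter fun G : EdgeGraph n => G.card = m,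
        (eqPairsZ r Pi (d + 1) G \ G).card := by
  rw [← Finset.card_sigma, ← Finset.card_sigma]
  refine Finset.card_le_card_of_injOn (fun p => ⟨p.1.erase p.2, p.2⟩) ?_ ?_
  · rintro ⟨G, e⟩ h
    simp only [Finset.coe_sigma, Set.mem_sigma_iff, Finset.mem_coe, Finset.mem_filter,
      Finset.mem_univ, true_and, Finset.mem_inter, Finset.mem_sdiff] at h ⊢
    obtain ⟨hG, h, he⟩ := h
    exact ⟨by rw [Finset.card_erase_of_mem he, hG]; rfl, mem_eqPairsZ_erase hPi hd he h,
      Finset.notMem_erase _ _⟩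
  · rintro ⟨G, e⟩ h ⟨G', e'⟩ h' heq
    simp only [Finset.coe_sigma, Set.mem_sigma_iff, Finset.mem_coe, Finset.mem_inter] at h h'
    simp only [Sigma.mk.injEq, heq_eq_eq] at heq
    obtain ⟨hE, rfl⟩ := heq
    rw [← Finset.insert_erase h.2.2, hE, Finset.insert_erase h'.2.2]

/-- For `G₁ ~ G(n,m)`, `G₂ ~ G(n,m+1)` and every `d ≥ -1`:
`E|eq_{d+1}^r(G₁) ∖ G₁| ≥ ((N-m)/(m+1)) E|eq_d^r(G₂) ∩ G₂|` where `N = C(n,2)`. -/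
theorem eq_d_d_plus_one
    (n r : ℕ) (hr : 2 ≤ r)
    (Pi : EdgeGraph n → (Fin n → Fin r)) (hPi : ∀ G : EdgeGraph n, cutSize (Pi G) G = maxCut n r G)
    (m : ℕ) (hm : m + 1 ≤ n.choose 2) (d : ℤ) (hd : -1 ≤ d) :
    ((n.choose 2 : ℝ) - m) / ((m : ℝ) + 1) *
        exGnm n (m + 1) (fun G => ((eqPairsZ r Pi d G ∩ G).card : ℝ)) ≤
      exGnm n m (fun G => ((eqPairsZ r Pi (d + 1) G \ G).card : ℝ)) := by
  have hchoose : ((n.choose 2).choose (m + 1) : ℝ) * (m + 1) =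
      (n.choose 2).choose m * (n.choose 2 - m) := by
    have h := Nat.choose_succ_right_eq (n.choose 2) m
    rw [← Nat.cast_sub (by lia)]
    exact_mod_cast h
  have hpos : (0 : ℝ) < (n.choose 2).choose m := by
    exact_mod_cast Nat.choose_pos (by lia)
  have hpos' : (0 : ℝ) < (n.choose 2).choose (m + 1) := by
    exact_mod_cast Nat.choose_pos hm
  have hm0 : (0 : ℝ) < m + 1 := by positivity
  have hcoef : ((n.choose 2 : ℝ) - m) / (m + 1) =
      (n.choose 2).choose (m + 1) / (n.choose 2).choose m := by
    rw [div_eq_div_iff hm0.ne' hpos.ne', hchoose, mul_comm]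
  unfold exGnm
  rw [card_filter_card_eq, card_filter_card_eq, hcoef, div_mul_div_comm,
    mul_comm ((n.choose 2).choose m : ℝ), mul_div_mul_left _ _ hpos'.ne']
  gcongr
  beta_reduce
  exact_mod_cast sum_card_eqPairsZ_inter_le hPi m hd

end
end
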